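/- Let n ≥ 1, let f_1, …, f_n : ℝ^d → ℝ be differentiable convex functions whose gradients are L-Lipschitz (L > 0), let f = (1/n)∑_{i=1}^n f_i, assume f is μ-strongly convex for some μ > 0, and let x* be the minimizer of f. Let p ∈ (0, 1], set θ = (1/2)·min{ 1, √(μ/(pL)) } and η = (1 − θ)/( L·θ·(2 − θ) ), and define Φ(w, x) = f(w) − f(x*) + ((1 + μη)pθ/(2η))·‖x − x*‖². Fix x₀ ∈ ℝ^d with Φ(w₀, x₀) > 0 where w₀ = x₀, let ε > 0, and run the ANITA recursion: for ω = ((i_0, b_0), …, (i_{T−1}, b_{T−1})) ∈ ({1,…,n} × {0,1})^T set u_t = θx_t + (1 − θ)w_t, g_t = ∇f_{i_t}(u_t) − ∇f_{i_t}(w_t) + ∇f(w_t), x_{t+1} = (1/(1 + μη))·(x_t + μη·u_t) − (η/(1 + μη))·g_t, and w_{t+1} = θx_{t+1} + (1 − θ)w_t if b_t = 1, else w_{t+1} = w_t. If T ≥ (5/(4pθ))·log( Φ(w₀, x₀)/ε ), then ∑_{ω ∈ ({1,…,n}×{0,1})^T} ( ∏_{t=0}^{T−1} (1/n)·p^{b_t}·(1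 − p)^{1 − b_t} )·( f(w_T(ω)) − f(x*) ) ≤ ε. -/

import Mathlib

open scoped RealInnerProductSpace

section Smooth

variable {E : Type*} [NormedAddCommGroup E] [InnerProductSpace ℝ E] [CompleteSpace E]

/-- The derivative of a differentiable function along a line. -/
theorem hasDerivAt_comp_add_smul {f : E → ℝ} (hf : Differentiable ℝ f) (x v : E) (t : ℝ) :
    HasDerivAt (fun s : ℝ => f (x + s • v)) ⟪gradient f (x + t • v), v⟫ t := by
  have h1 : HasDerivAt (fun s : ℝ => x + s • v) v t := by
    simpa using ((hasDerivAt_id t).smul_const v).const_add x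
  rw [inner_gradient_left]
  exact (hf (x + t • v)).hasFDerivAt.comp_hasDerivAt t h1

/-- The descent lemma: a function with `L`-Lipschitz gradient lies below its quadratic
upper model. -/
theorem le_add_inner_gradient_add_sq {f : E → ℝ} {L : ℝ} (hf : Differentiable ℝ f)
    (hlip : ∀ x y, ‖gradient f x - gradient f y‖ ≤ L * ‖x - y‖) (x y : E) :
    f y ≤ f x + ⟪gradient f x, y - x⟫ + L / 2 * ‖y - x‖ ^ 2 := by
  set v := y - x with hv
  have hB : ∀ t : ℝ, HasDerivAt (fun s : ℝ => f x + s * ⟪gradient f x, v⟫ + L / 2 * ‖v‖ ^ 2 * s ^ 2)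
      (⟪gradient f x, v⟫ + L * ‖v‖ ^ 2 * t) t := by
    intro t
    have h1 := ((hasDerivAt_id t).mul_const ⟪gradient f x, v⟫).const_add (f x)
    have h2 := ((hasDerivAt_id t).pow 2).const_mul (L / 2 * ‖v‖ ^ 2)
    convert! h1.add h2 using 1
    simp
    ring
  have key := image_le_of_deriv_right_le_deriv_boundary (a := (0 : ℝ)) (b := 1)
    (f := fun s : ℝ => f (x + s • v))
    (fun t _ => (hasDerivAt_comp_add_smul hf x v t).continuousAt.continuousWithinAt)
    (fun t _ => (hasDerivAt_comp_add_smul hf x v t).hasDerivWithinAt)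
    (by simp)
    (fun t _ => (hB t).continuousAt.continuousWithinAt)
    (fun t _ => (hB t).hasDerivWithinAt)
    (fun t ht => by
      have h1 : ⟪gradient f (x + t • v) - gradient f x, v⟫ ≤ L * ‖v‖ ^ 2 * t := by
        calc _ ≤ ‖gradient f (x + t • v) - gradient f x‖ * ‖v‖ := real_inner_le_norm _ _
          _ ≤ L * ‖x + t • v - x‖ * ‖v‖ := by gcongr; exact hlip _ _
          _ = L * ‖v‖ ^ 2 * t := by
            rw [add_sub_cancel_left, norm_smul, Real.norm_of_nonneg ht.1]; ring
      rw [inner_sub_left] at h1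
      linarith)
    (Set.right_mem_Icc.2 zero_le_one)
  simpa [hv] using key

/-- First-order characterization of convexity. -/
theorem ConvexOn.add_inner_gradient_le {f : E → ℝ} (hf : Differentiable ℝ f)
    (hc : ConvexOn ℝ Set.univ f) (x y : E) : f x + ⟪gradient f x, y - x⟫ ≤ f y := by
  have hline : ConvexOn ℝ Set.univ (fun s : ℝ => f (x + s • (y - x))) := by
    refine ⟨convex_univ, fun s _ t _ a b ha hb hab => ?_⟩
    have h := hc.2 (Set.mem_univ (x + s • (y - x))) (Set.mem_univ (x + t • (y - x))) ha hb hab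
    convert! h using 2
    obtain rfl : b = 1 - a := by linarith
    simp only [smul_eq_mul]
    module
  have h := hline.le_slope_of_hasDerivAt (Set.mem_univ 0) (Set.mem_univ 1) zero_lt_one
    (hasDerivAt_comp_add_smul hf x (y - x) 0)
  simp only [slope_def_field, zero_smul, add_zero, one_smul, add_sub_cancel, sub_zero,
    div_one] at h
  linarith

/-- The Bregman divergence of a convex function with `L`-Lipschitz gradient controls the
squared difference of the gradients. -/
theorem ConvexOn.norm_gradient_sub_sq_le {f : E → ℝ} {L : ℝ} (hL : 0 < L)
    (hf : Differentiable ℝ f) (hc : ConvexOn ℝ Set.univ f)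
    (hlip : ∀ x y, ‖gradient f x - gradient f y‖ ≤ L * ‖x - y‖) (u w : E) :
    ‖gradient f u - gradient f w‖ ^ 2 ≤ 2 * L * (f w - f u - ⟪gradient f u, w - u⟫) := by
  set v := gradient f u - gradient f w with hv
  have h1 := le_add_inner_gradient_add_sq hf hlip w (w + (1 / L) • v)
  have h2 := hc.add_inner_gradient_le hf u (w + (1 / L) • v)
  have h3 : ⟪gradient f u, w + (1 / L) • v - u⟫ - ⟪gradient f w, (1 / L) • v⟫
      = ⟪gradient f u, w - u⟫ + 1 / L * ‖v‖ ^ 2 := by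
    rw [← real_inner_self_eq_norm_sq v]
    nth_rw 3 [hv]
    simp only [inner_sub_left, inner_sub_right, inner_add_right, real_inner_smul_right]
    ring
  rw [add_sub_cancel_left, norm_smul, mul_pow, Real.norm_of_nonneg (by positivity)] at h1
  have h4 : L / 2 * ((1 / L) ^ 2 * ‖v‖ ^ 2) = 1 / L * ‖v‖ ^ 2 / 2 := by field_simp
  have h5 : 1 / L * ‖v‖ ^ 2 / 2 ≤ f w - f u - ⟪gradient f u, w - u⟫ := by linarith
  calc ‖v‖ ^ 2 = 2 * L * (1 / L * ‖v‖ ^ 2 / 2) := by field_simp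
    _ ≤ _ := by gcongr

theorem hasGradientAt_average {ι : Type*} [Fintype ι] {f : ι → E → ℝ}
    (hf : ∀ i, Differentiable ℝ (f i)) (c : ℝ) (x : E) :
    HasGradientAt (fun y => c * ∑ i, f i y) (c • ∑ i, gradient (f i) x) x := by
  rw [hasGradientAt_iff_hasFDerivAt]
  have h := (HasFDerivAt.fun_sum (u := Finset.univ)
    fun i _ => ((hf i x).hasGradientAt).hasFDerivAt).const_mul c
  convert! h using 1
  simp

end Smooth

section Coupling

variable {E : Type*} [NormedAddCommGroup E] [InnerProductSpace ℝ E]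

/-- The variance of a finite family is at most its second moment. -/
theorem sum_norm_sub_average_sq_le {ι : Type*} [Fintype ι] [Nonempty ι] (v : ι → E) (m : E)
    (hm : ∑ i, v i = (Fintype.card ι : ℝ) • m) : ∑ i, ‖v i - m‖ ^ 2 ≤ ∑ i, ‖v i‖ ^ 2 := by
  have h : ∑ i, ‖v i - m‖ ^ 2 = ∑ i, ‖v i‖ ^ 2 - Fintype.card ι * ‖m‖ ^ 2 := by
    simp only [norm_sub_sq_real, Finset.sum_add_distrib, Finset.sum_sub_distrib,
      ← Finset.mul_sum, ← sum_inner, hm, real_inner_smul_left, real_inner_self_eq_norm_sq,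
      Finset.sum_const, Finset.card_univ, nsmul_eq_mul]
    ring
  rw [h]
  have : 0 ≤ (Fintype.card ι : ℝ) * ‖m‖ ^ 2 := by positivity
  linarith

/-- One proximal step along a stochastic gradient `g`, applied to a function whose quadratic
upper model at `u` has gradient `G`. -/
theorem prox_step_bound {L θ μ η : ℝ} (hL : 0 < L) (hθ0 : 0 < θ) (hθ1 : θ < 1) (hμ : 0 < μ)
    (hη : η = (1 - θ) / (L * θ * (2 - θ))) (x u z g G x' : E)
    (hx' : x' = (1 / (1 + μ * η)) • (x + (μ * η) • u) - (η / (1 + μ * η)) • g) :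
    θ * ⟪G, x' - x⟫ + L / 2 * (θ ^ 2 * ‖x' - x‖ ^ 2)
      ≤ θ / (2 * η) * ‖x - z‖ ^ 2 - θ * (1 + μ * η) / (2 * η) * ‖x' - z‖ ^ 2
        + θ * μ / 2 * ‖u - z‖ ^ 2 - θ * ⟪g, x - z⟫ + (1 - θ) / (2 * L) * ‖G - g‖ ^ 2 := by
  have h1θ : 0 < 1 - θ := by linarith
  have h2θ : 0 < 2 - θ := by linarith
  have hηpos : 0 < η := by rw [hη]; positivity
  have hηinv : 1 / η = L * θ * (2 - θ) / (1 - θ) := by rw [hη, one_div_div]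
  have hpos : 0 < 1 + μ * η := by positivity
  obtain ⟨a, rfl⟩ : ∃ a, x' = x + a := ⟨x' - x, by abel⟩
  obtain ⟨b, rfl⟩ : ∃ b, x = z + b := ⟨x - z, by abel⟩
  obtain ⟨c, rfl⟩ : ∃ c, u = z + b + c := ⟨u - (z + b), by abel⟩
  have hg : g = μ • c - (1 / η + μ) • a := by
    have h : a = (1 / (1 + μ * η)) • ((μ * η) • c - η • g) := by
      have h0 : a = (1 / (1 + μ * η)) • (z + b + (μ * η) • (z + b + c))
          - (η / (1 + μ * η)) • g - (z + b) := by rw [← hx']; abel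
      rw [h0]
      match_scalars <;> field_simp <;> ring
    rw [h]
    match_scalars <;> field_simp
    ring
  have young : θ * ⟪G - g, a⟫
      ≤ (1 - θ) / (2 * L) * ‖G - g‖ ^ 2 + L * θ ^ 2 / (2 * (1 - θ)) * ‖a‖ ^ 2 := by
    have h := sq_nonneg ‖(1 - θ) • (G - g) - (L * θ) • a‖
    rw [norm_sub_sq_real, norm_smul, norm_smul, real_inner_smul_left, real_inner_smul_right,
      mul_pow, mul_pow, Real.norm_eq_abs, Real.norm_eq_abs, sq_abs, sq_abs] at h
    have e : (1 - θ) / (2 * L) * ‖G - g‖ ^ 2 + L * θ ^ 2 / (2 * (1 - θ)) * ‖a‖ ^ 2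
        - θ * ⟪G - g, a⟫ = ((1 - θ) ^ 2 * ‖G - g‖ ^ 2
          - 2 * ((1 - θ) * (L * θ * ⟪G - g, a⟫)) + (L * θ) ^ 2 * ‖a‖ ^ 2)
          / (2 * L * (1 - θ)) := by
      field_simp
      ring
    have : 0 ≤ (1 - θ) / (2 * L) * ‖G - g‖ ^ 2 + L * θ ^ 2 / (2 * (1 - θ)) * ‖a‖ ^ 2
        - θ * ⟪G - g, a⟫ := by rw [e]; positivity
    linarith
  have hcoef : L / 2 * θ ^ 2 + L * θ ^ 2 / (2 * (1 - θ)) = θ / 2 * (1 / η) := by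
    rw [hηinv]; field_simp; ring
  have hsq : 0 ≤ θ * μ / 2 * ‖a - c‖ ^ 2 := by positivity
  have hident : θ / (2 * η) * ‖b‖ ^ 2 - θ * (1 + μ * η) / (2 * η) * ‖b + a‖ ^ 2
      + θ * μ / 2 * ‖b + c‖ ^ 2 - θ * ⟪g, b⟫ - θ * ⟪g, a⟫ - θ / 2 * (1 / η) * ‖a‖ ^ 2
      = θ * μ / 2 * ‖a - c‖ ^ 2 := by
    rw [hg]
    simp only [norm_add_sq_real, norm_sub_sq_real, inner_sub_left, real_inner_smul_left,
      real_inner_self_eq_norm_sq, real_inner_comm c a, real_inner_comm c b, real_inner_comm b a]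
    field_simp
    ring
  rw [inner_sub_left] at young
  have e1 : z + b + a - (z + b) = a := by abel
  have e2 : z + b - z = b := by abel
  have e3 : z + b + a - z = b + a := by abel
  have e4 : z + b + c - z = b + c := by abel
  rw [e1, e2, e3, e4]
  linear_combination young + hsq - hident + ‖a‖ ^ 2 * hcoef

end Coupling

section Anita

variable {E : Type*} [NormedAddCommGroup E] [InnerProductSpace ℝ E] [CompleteSpace E] {n : ℕ}

/-- The `x`-update of ANITA from the state `(x, w)` when the index `i` is drawn. -/
noncomputable def anitaX (f : Fin n → E → ℝ) (F : E → ℝ) (μ θ η : ℝ) (x w : E) (i : Fin n) : E :=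
  (1 / (1 + μ * η)) • (x + (μ * η) • (θ • x + (1 - θ) • w))
    - (η / (1 + μ * η)) •
        (gradient (f i) (θ • x + (1 - θ) • w) - gradient (f i) w + gradient F w)

/-- One step of ANITA from the state `(x, w)` with index `i` and coin `b`. -/
noncomputable def anitaStep (f : Fin n → E → ℝ) (F : E → ℝ) (μ θ η : ℝ) (a : Fin n × Bool)
    (s : E × E) : E × E :=
  (anitaX f F μ θ η s.1 s.2 a.1,
    if a.2 then θ • anitaX f F μ θ η s.1 s.2 a.1 + (1 - θ) • s.2 else s.2)

variable {f : Fin n → E → ℝ} {F : E → ℝ} {L μ θ η : ℝ}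

/-- Expected progress of the ANITA coupling step, summed over the drawn index. -/
theorem sum_anita_coupling_le (hn : 1 ≤ n) (hL : 0 < L) (hdiff : ∀ i, Differentiable ℝ (f i))
    (hconv : ∀ i, ConvexOn ℝ Set.univ (f i))
    (hlip : ∀ i x y, ‖gradient (f i) x - gradient (f i) y‖ ≤ L * ‖x - y‖)
    (hF : F = fun x => (1 / (n : ℝ)) * ∑ i, f i x) (hμ : 0 < μ)
    (hsc : ∀ x y, F x - F y - ⟪gradient F y, x - y⟫ ≥ (μ / 2) * ‖x - y‖ ^ 2)
    (hθ0 : 0 < θ) (hθ1 : θ < 1) (hη : η = (1 - θ) / (L * θ * (2 - θ))) (x w z : E) :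
    ∑ i, (F (θ • anitaX f F μ θ η x w i + (1 - θ) • w) - F z
        + θ * (1 + μ * η) / (2 * η) * ‖anitaX f F μ θ η x w i - z‖ ^ 2)
      ≤ n * ((1 - θ) * (F w - F z) + θ / (2 * η) * ‖x - z‖ ^ 2) := by
  have hn0 : (0 : ℝ) < n := by exact_mod_cast hn
  have : Nonempty (Fin n) := ⟨⟨0, hn⟩⟩
  set u := θ • x + (1 - θ) • w with hu
  have hgrad : ∀ y, gradient F y = (1 / (n : ℝ)) • ∑ i, gradient (f i) y := fun y => by
    rw [hF]; exact (hasGradientAt_average hdiff _ y).gradient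
  have hsum : ∀ y, ∑ i, gradient (f i) y = (n : ℝ) • gradient F y := fun y => by
    rw [hgrad, smul_smul, mul_one_div_cancel hn0.ne', one_smul]
  have hFsum : ∀ y, ∑ i, f i y = n * F y := fun y => by
    rw [hF]; field_simp
  have hFdiff : Differentiable ℝ F := fun y => by
    rw [hF]; exact (hasGradientAt_average hdiff _ y).differentiableAt
  have hFlip : ∀ a b, ‖gradient F a - gradient F b‖ ≤ L * ‖a - b‖ := fun a b => by
    rw [hgrad, hgrad, ← smul_sub, ← Finset.sum_sub_distrib, norm_smul,
      Real.norm_of_nonneg (by positivity)]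
    calc _ ≤ 1 / (n : ℝ) * ∑ _i : Fin n, L * ‖a - b‖ := by
          gcongr; exact norm_sum_le_of_le _ fun i _ => hlip i a b
      _ = L * ‖a - b‖ := by simp; field_simp
  set G := gradient F u with hG
  set g : Fin n → E := fun i => gradient (f i) u - gradient (f i) w + gradient F w with hg
  set D := F w - F u - ⟪G, w - u⟫ with hD
  have hgsum : ∑ i, g i = (n : ℝ) • G := by
    simp only [hg, Finset.sum_add_distrib, Finset.sum_sub_distrib, hsum, Finset.sum_const,
      Finset.card_univ, Fintype.card_fin, ← Nat.cast_smul_eq_nsmul ℝ, sub_add_cancel, hG]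
  have hvar : ∑ i, ‖G - g i‖ ^ 2 ≤ n * (2 * L * D) := by
    calc ∑ i, ‖G - g i‖ ^ 2
        = ∑ i, ‖gradient (f i) u - gradient (f i) w - (G - gradient F w)‖ ^ 2 :=
          Finset.sum_congr rfl fun i _ => by
            rw [← norm_neg]; congr 2; simp only [hg]; abel
      _ ≤ ∑ i, ‖gradient (f i) u - gradient (f i) w‖ ^ 2 :=
          sum_norm_sub_average_sq_le _ _ (by
            rw [Finset.sum_sub_distrib, hsum, hsum, Fintype.card_fin, smul_sub])
      _ ≤ ∑ i, 2 * L * (f i w - f i u - ⟪gradient (f i) u, w - u⟫) :=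
          Finset.sum_le_sum fun i _ =>
            (hconv i).norm_gradient_sub_sq_le hL (hdiff i) (hlip i) u w
      _ = n * (2 * L * D) := by
          rw [← Finset.mul_sum, Finset.sum_sub_distrib, Finset.sum_sub_distrib, hFsum, hFsum,
            ← sum_inner, hsum, real_inner_smul_left]
          ring
  have hstep : ∀ i, F (θ • anitaX f F μ θ η x w i + (1 - θ) • w) - F z
        + θ * (1 + μ * η) / (2 * η) * ‖anitaX f F μ θ η x w i - z‖ ^ 2
      ≤ F u - F z + θ / (2 * η) * ‖x - z‖ ^ 2 + θ * μ / 2 * ‖u - z‖ ^ 2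
        - θ * ⟪g i, x - z⟫ + (1 - θ) / (2 * L) * ‖G - g i‖ ^ 2 := fun i => by
    have h1 := prox_step_bound hL hθ0 hθ1 hμ hη x u z (g i) G (anitaX f F μ θ η x w i) rfl
    have h2 := le_add_inner_gradient_add_sq hFdiff hFlip u
      (θ • anitaX f F μ θ η x w i + (1 - θ) • w)
    have h3 : θ • anitaX f F μ θ η x w i + (1 - θ) • w - u
        = θ • (anitaX f F μ θ η x w i - x) := by rw [hu]; module
    rw [h3, real_inner_smul_right, norm_smul, mul_pow, Real.norm_of_nonneg hθ0.le] at h2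
    linarith
  have hcouple : θ * ⟪G, x - z⟫ = θ * ⟪G, u - z⟫ - (1 - θ) * ⟪G, w - u⟫ := by
    rw [← real_inner_smul_right, ← real_inner_smul_right, ← real_inner_smul_right,
      ← inner_sub_right]
    congr 1
    rw [hu]; module
  have hstrong : F u - F z + μ / 2 * ‖u - z‖ ^ 2 ≤ ⟪G, u - z⟫ := by
    have h := hsc z u
    rw [norm_sub_rev, ← neg_sub u z, inner_neg_right] at h
    linarith
  have hvar' : (1 - θ) / (2 * L) * ∑ i, ‖G - g i‖ ^ 2 ≤ n * ((1 - θ) * D) := by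
    have h1θ : 0 ≤ 1 - θ := by linarith
    calc _ ≤ (1 - θ) / (2 * L) * (n * (2 * L * D)) := by gcongr
      _ = _ := by field_simp
  refine (Finset.sum_le_sum fun i _ => hstep i).trans ?_
  rw [Finset.sum_add_distrib, Finset.sum_sub_distrib, ← Finset.mul_sum, ← Finset.mul_sum,
    ← sum_inner, hgsum, real_inner_smul_left, Finset.sum_const, Finset.card_univ,
    Fintype.card_fin, nsmul_eq_mul]
  linear_combination hvar' + n * θ * hstrong - n * hcouple + n * (1 - θ) * hD

/-- A potential contracts in expectation by a factor `1 - 4pθ/5` along one ANITA step. -/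
theorem sum_anitaStep_potential_le (hn : 1 ≤ n) (hL : 0 < L)
    (hdiff : ∀ i, Differentiable ℝ (f i)) (hconv : ∀ i, ConvexOn ℝ Set.univ (f i))
    (hlip : ∀ i x y, ‖gradient (f i) x - gradient (f i) y‖ ≤ L * ‖x - y‖)
    (hF : F = fun x => (1 / (n : ℝ)) * ∑ i, f i x) (hμ : 0 < μ)
    (hsc : ∀ x y, F x - F y - ⟪gradient F y, x - y⟫ ≥ (μ / 2) * ‖x - y‖ ^ 2)
    {z : E} (hmin : ∀ y, F z ≤ F y) {p : ℝ} (hp : p ∈ Set.Ioc (0 : ℝ) 1)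
    (hθ0 : 0 < θ) (hθ2 : θ ≤ 1 / 2) (hθμ : 4 * p * L * θ ^ 2 ≤ μ)
    (hη : η = (1 - θ) / (L * θ * (2 - θ))) {Φ : E → E → ℝ}
    (hΦ : ∀ w x, Φ w x = F w - F z + ((1 + μ * η) * p * θ / (2 * η)) * ‖x - z‖ ^ 2)
    (s : E × E) :
    ∑ a : Fin n × Bool, ((1 / (n : ℝ)) * (if a.2 then p else 1 - p)) *
        Φ (anitaStep f F μ θ η a s).2 (anitaStep f F μ θ η a s).1
      ≤ (1 - 4 * p * θ / 5) * Φ s.2 s.1 := by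
  obtain ⟨x, w⟩ := s
  obtain ⟨hp0, hp1⟩ := hp
  have hn0 : (0 : ℝ) < n := by exact_mod_cast hn
  have h2θ : 0 < 2 - θ := by linarith
  have h1θ : 0 < 1 - θ := by linarith
  have hηpos : 0 < η := by rw [hη]; positivity
  have hμη : 4 * p * θ / 3 ≤ μ * η := by
    have h1 : 4 * p * L * θ ^ 2 * η ≤ μ * η := by gcongr
    have h2 : 4 * p * L * θ ^ 2 * η = 4 * p * θ * ((1 - θ) / (2 - θ)) := by
      rw [hη]; field_simp
    have h3 : 1 / 3 ≤ (1 - θ) / (2 - θ) := by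
      rw [div_le_div_iff₀ (by norm_num) h2θ]; linarith
    have h4 : 4 * p * θ * (1 / 3) ≤ 4 * p * θ * ((1 - θ) / (2 - θ)) := by gcongr
    linarith
  have hpθ : p * θ ≤ 1 / 2 := by nlinarith
  have hpθ0 : 0 < p * θ := by positivity
  have hrate : 1 ≤ (1 - 4 * p * θ / 5) * (1 + μ * η) := by
    calc 1 ≤ (1 - 4 * p * θ / 5) * (1 + 4 * p * θ / 3) := by nlinarith
      _ ≤ _ := by
        have : 0 ≤ 1 - 4 * p * θ / 5 := by linarith
        gcongr
  have hcouple := sum_anita_coupling_le hn hL hdiff hconv hlip hF hμ hsc hθ0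
    (by linarith) hη x w z
  have hexpand : ∑ a : Fin n × Bool, ((1 / (n : ℝ)) * (if a.2 then p else 1 - p)) *
        Φ (anitaStep f F μ θ η a (x, w)).2 (anitaStep f F μ θ η a (x, w)).1
      = (1 - p) * (F w - F z) + p / n *
        ∑ i, (F (θ • anitaX f F μ θ η x w i + (1 - θ) • w) - F z
          + θ * (1 + μ * η) / (2 * η) * ‖anitaX f F μ θ η x w i - z‖ ^ 2) := by
    have hconst : (1 - p) * (F w - F z) = ∑ _i : Fin n, (1 - p) / n * (F w - F z) := by
      simp; field_simp
    rw [Fintype.sum_prod_type, hconst, Finset.mul_sum, ← Finset.sum_add_distrib]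
    refine Finset.sum_congr rfl fun i _ => ?_
    simp only [Fintype.sum_bool, anitaStep, hΦ, if_true, Bool.false_eq_true, if_false]
    field_simp
    ring
  rw [hexpand, hΦ]
  have hFw : 0 ≤ F w - F z := sub_nonneg.2 (hmin w)
  calc _ ≤ (1 - p) * (F w - F z)
        + p / n * (n * ((1 - θ) * (F w - F z) + θ / (2 * η) * ‖x - z‖ ^ 2)) := by gcongr
    _ = (1 - p * θ) * (F w - F z) + 1 * (p * θ / (2 * η) * ‖x - z‖ ^ 2) := by
      field_simp; ring
    _ ≤ (1 - 4 * p * θ / 5) * (F w - F z)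
        + (1 - 4 * p * θ / 5) * (1 + μ * η) * (p * θ / (2 * η) * ‖x - z‖ ^ 2) := by
      gcongr ?_ * _ + ?_ * _
      linarith
    _ = _ := by ring

end Anita

/-- If a potential contracts in expectation by a factor `ρ` along each step of a random
recursion driven by independent draws from the weights `q`, then after `T` steps its expectation
has contracted by `ρ ^ T`. -/
theorem sum_prod_weight_mul_potential_le {A S : Type*} [Fintype A] {q : A → ℝ}
    (hq : ∀ a, 0 ≤ q a) {step : A → S → S} {V : S → ℝ} {ρ : ℝ} (hρ : 0 ≤ ρ)
    (hV : ∀ s, ∑ a, q a * V (step a s) ≤ ρ * V s) (T : ℕ) (s : S) (Y : (Fin T → A) → ℕ → S)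
    (hY0 : ∀ ω, Y ω 0 = s) (hY : ∀ ω, ∀ t : Fin T, Y ω ((t : ℕ) + 1) = step (ω t) (Y ω t)) :
    ∑ ω : Fin T → A, (∏ t, q (ω t)) * V (Y ω T) ≤ ρ ^ T * V s := by
  induction T generalizing s with
  | zero => simp [hY0]
  | succ T ih =>
    rw [← (Fin.consEquiv fun _ : Fin (T + 1) => A).sum_comp, Fintype.sum_prod_type]
    calc _ = ∑ a, q a * ∑ ω : Fin T → A, (∏ t, q (ω t)) *
            V (Y (Fin.cons a ω : Fin (T + 1) → A) (T + 1)) := by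
          refine Finset.sum_congr rfl fun a _ => ?_
          rw [Finset.mul_sum]
          refine Finset.sum_congr rfl fun ω _ => ?_
          simp [Fin.consEquiv, Fin.prod_univ_succ, mul_assoc]
      _ ≤ ∑ a, q a * (ρ ^ T * V (step a s)) := by
          gcongr with a _
          · exact hq a
          refine ih (step a s) (fun ω t => Y (Fin.cons a ω : Fin (T + 1) → A) (t + 1))
            (fun ω => ?_) (fun ω t => ?_)
          · simpa [hY0] using hY (Fin.cons a ω) 0
          · simpa using hY (Fin.cons a ω) t.succ
      _ = ρ ^ T * ∑ a, q a * V (step a s) := by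
          rw [Finset.mul_sum]
          exact Finset.sum_congr rfl fun a _ => by ring
      _ ≤ ρ ^ T * (ρ * V s) := by gcongr; exact hV s
      _ = ρ ^ (T + 1) * V s := by ring

/-- Geometric decay at rate `1 - c` brings `a` below `ε` within `log (a / ε) / c` steps. -/
theorem one_sub_pow_mul_le {c a ε : ℝ} (hc0 : 0 < c) (hc1 : c ≤ 1) (ha : 0 < a) (hε : 0 < ε)
    {T : ℕ} (hT : 1 / c * Real.log (a / ε) ≤ T) : (1 - c) ^ T * a ≤ ε := by
  have hlog : Real.log (a / ε) ≤ c * T := by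
    rwa [one_div, inv_mul_le_iff₀ hc0] at hT
  have hexp : a / ε ≤ Real.exp (c * T) := by rwa [← Real.log_le_iff_le_exp (by positivity)]
  have hpow : (1 - c) ^ T ≤ Real.exp (-(c * T)) := by
    calc (1 - c) ^ T ≤ Real.exp (-c) ^ T :=
          pow_le_pow_left₀ (by linarith) (Real.one_sub_le_exp_neg c) T
      _ = Real.exp (-(c * T)) := by rw [← Real.exp_nat_mul]; ring_nf
  calc (1 - c) ^ T * a ≤ Real.exp (-(c * T)) * (ε * Real.exp (c * T)) := by
        gcongr
        rwa [div_le_iff₀' hε] at hexp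
    _ = ε := by rw [mul_left_comm, ← Real.exp_add]; simp

/-- Corollary 2 of the paper (iteration bound for ANITA in the strongly convex case):
if `T ≥ (5/(4pθ)) log(Φ₀/ε)`, then `E[f(w_T) − f(x*)] ≤ ε`, with the expectation over the
`T` independent uniform indices and Bernoulli(`p`) coins written as an explicit weighted
sum over sample paths. -/
theorem anita_strongly_convex_iteration_bound {d n : ℕ} (hn : 1 ≤ n)
    (f : Fin n → EuclideanSpace ℝ (Fin d) → ℝ) (L : ℝ) (hL : 0 < L)
    (hdiff : ∀ i, Differentiable ℝ (f i))
    (hconv : ∀ i, ConvexOn ℝ Set.univ (f i))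
    (hlip : ∀ i x y, ‖gradient (f i) x - gradient (f i) y‖ ≤ L * ‖x - y‖)
    (F : EuclideanSpace ℝ (Fin d) → ℝ)
    (hF : F = fun x => (1 / (n : ℝ)) * ∑ i, f i x)
    (μ : ℝ) (hμ : 0 < μ)
    (hsc : ∀ x y, F x - F y - ⟪gradient F y, x - y⟫ ≥ (μ / 2) * ‖x - y‖ ^ 2)
    (xstar : EuclideanSpace ℝ (Fin d)) (hmin : ∀ y, F xstar ≤ F y)
    (p : ℝ) (hp : p ∈ Set.Ioc (0 : ℝ) 1) (θ η : ℝ)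
    (hθ : θ = (1 / 2) * min 1 (Real.sqrt (μ / (p * L))))
    (hη : η = (1 - θ) / (L * θ * (2 - θ)))
    (Φ : EuclideanSpace ℝ (Fin d) → EuclideanSpace ℝ (Fin d) → ℝ)
    (hΦ : ∀ w x, Φ w x = F w - F xstar + ((1 + μ * η) * p * θ / (2 * η)) * ‖x - xstar‖ ^ 2)
    (x0 : EuclideanSpace ℝ (Fin d)) (hΦ0 : 0 < Φ x0 x0)
    (ε : ℝ) (hε : 0 < ε) (T : ℕ)
    (hT : (T : ℝ) ≥ (5 / (4 * p * θ)) * Real.log (Φ x0 x0 / ε))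
    (X W : (Fin T → Fin n × Bool) → ℕ → EuclideanSpace ℝ (Fin d))
    (hX0 : ∀ ω, X ω 0 = x0) (hW0 : ∀ ω, W ω 0 = x0)
    (hXrec : ∀ ω, ∀ t : Fin T,
      X ω ((t : ℕ) + 1) =
        (1 / (1 + μ * η)) • (X ω t + (μ * η) • (θ • X ω t + (1 - θ) • W ω t))
          - (η / (1 + μ * η)) •
              (gradient (f (ω t).1) (θ • X ω t + (1 - θ) • W ω t)
                - gradient (f (ω t).1) (W ω t) + gradient F (W ω t)))
    (hWrec : ∀ ω, ∀ t : Fin T,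
      W ω ((t : ℕ) + 1) =
        if (ω t).2 then θ • X ω ((t : ℕ) + 1) + (1 - θ) • W ω t else W ω t) :
    ∑ ω : Fin T → Fin n × Bool,
        (∏ t : Fin T, (1 / (n : ℝ)) * (if (ω t).2 then p else 1 - p)) *
          (F (W ω T) - F xstar) ≤ ε := by
  obtain ⟨hp0, hp1⟩ := hp
  have hθ0 : 0 < θ := by
    rw [hθ]; have : 0 < min 1 (Real.sqrt (μ / (p * L))) := lt_min one_pos (by positivity)
    positivity
  have hθ2 : θ ≤ 1 / 2 := by linarith [min_le_left 1 (Real.sqrt (μ / (p * L)))]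
  have hθμ : 4 * p * L * θ ^ 2 ≤ μ := by
    have h1 : 2 * θ ≤ Real.sqrt (μ / (p * L)) := by
      linarith [min_le_right 1 (Real.sqrt (μ / (p * L)))]
    have h2 : (2 * θ) ^ 2 ≤ μ / (p * L) :=
      (Real.le_sqrt (by positivity) (by positivity)).1 h1
    rw [le_div_iff₀ (by positivity)] at h2
    linarith
  have hηpos : 0 < η := by
    have : 0 < 1 - θ := by linarith
    have : 0 < 2 - θ := by linarith
    rw [hη]; positivity
  have hpθ : p * θ ≤ 1 / 2 := by nlinarith
  have hpθ0 : 0 < p * θ := by positivity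
  have hq : ∀ a : Fin n × Bool, 0 ≤ (1 / (n : ℝ)) * (if a.2 then p else 1 - p) := fun a => by
    have : 0 ≤ 1 - p := by linarith
    split_ifs <;> positivity
  calc _ ≤ ∑ ω : Fin T → Fin n × Bool,
          (∏ t : Fin T, (1 / (n : ℝ)) * (if (ω t).2 then p else 1 - p)) *
            Φ (W ω T) (X ω T) := by
        gcongr with ω _
        rw [hΦ]
        exact le_add_of_nonneg_right (by positivity)
    _ ≤ (1 - 4 * p * θ / 5) ^ T * Φ x0 x0 :=
        sum_prod_weight_mul_potential_le (V := fun s => Φ s.2 s.1)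
          (step := anitaStep f F μ θ η) hq (by linarith)
          (sum_anitaStep_potential_le hn hL hdiff hconv hlip hF hμ hsc hmin ⟨hp0, hp1⟩
            hθ0 hθ2 hθμ hη hΦ) T (x0, x0) (fun ω t => (X ω t, W ω t))
          (fun ω => by rw [hX0, hW0])
          (fun ω t => by
            have h : X ω (t + 1) = anitaX f F μ θ η (X ω t) (W ω t) (ω t).1 := hXrec ω t
            simp only [anitaStep, hWrec ω t, h])
    _ ≤ ε := by
        refine one_sub_pow_mul_le (by positivity) (by linarith) hΦ0 hε ?_
        rw [one_div_div]
        exact hT
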